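/- arXiv:2107.14307 — 2 statements merged into one kernel-verified Lean document; each statement's English description precedes it below -/
import Mathlib

section
/- Let ν > 0, k > 0, and set λ = min(ν, k). Let û : ℝ × ℝ → ℝ (written û(t,x)) be twice continuously differentiable with ∂ₜû(t,x) = ν·∂ₓₓû(t,x) for all t ≥ 0 and x ∈ [0,1], and boundary conditions ν·∂ₓû(t,0) = k·û(t,0) and ν·∂ₓû(t,1) = −k·û(t,1) for all t ≥ 0. Then for every t ≥ 0, (∫₀¹ û(t,x)² dx)^{1/2} ≤ (∫₀¹ û(0,x)² dx)^{1/2} · e^{−λt/2}. -/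
/-- Partial derivative in the first (time) variable. -/
noncomputable def pt (w : ℝ × ℝ → ℝ) (t x : ℝ) : ℝ := deriv (fun s => w (s, x)) t

/-- First partial derivative in the second (space) variable. -/
noncomputable def px (w : ℝ × ℝ → ℝ) (t x : ℝ) : ℝ := deriv (fun y => w (t, y)) x

/-- Second partial derivative in the second (space) variable. -/
noncomputable def pxx (w : ℝ × ℝ → ℝ) (t x : ℝ) : ℝ := deriv (fun y => px w t y) x

open Set Filter Topology MeasureTheory in
/-- Differentiation under the integral sign over a compact interval, for an integrand whose
derivative in the parameter is jointly continuous. -/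
theorem hasDerivAt_intervalIntegral_of_continuous {F F' : ℝ → ℝ → ℝ} {a b : ℝ}
    (hF : ∀ t, Continuous (F t)) (hF' : Continuous fun p : ℝ × ℝ => F' p.1 p.2)
    (hderiv : ∀ t x, HasDerivAt (fun s => F s x) (F' t x) t) (t : ℝ) :
    HasDerivAt (fun s => ∫ x in a..b, F s x) (∫ x in a..b, F' t x) t := by
  obtain ⟨C, hC⟩ := ((isCompact_closedBall t 1).prod (isCompact_uIcc (a := a) (b := b))
    ).exists_bound_of_continuousOn hF'.continuousOn
  refine (intervalIntegral.hasDerivAt_integral_of_dominated_loc_of_deriv_le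
    (bound := fun _ => C) (Metric.closedBall_mem_nhds t one_pos)
    (Eventually.of_forall fun s => (hF s).aestronglyMeasurable)
    ((hF t).intervalIntegrable a b)
    (Continuous.aestronglyMeasurable (by fun_prop)) ?_ intervalIntegrable_const
    (Eventually.of_forall fun x _ s _ => hderiv s x)).2
  exact Eventually.of_forall fun x hx s hs => hC (s, x) ⟨hs, uIoc_subset_uIcc hx⟩

theorem hasDerivAt_comp_prodMk_left {w : ℝ × ℝ → ℝ} (hw : Differentiable ℝ w) (t x : ℝ) :
    HasDerivAt (fun s => w (s, x)) (fderiv ℝ w (t, x) (1, 0)) t :=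
  (hw (t, x)).hasFDerivAt.comp_hasDerivAt t ((hasDerivAt_id t).prodMk (hasDerivAt_const t x))

theorem continuous_pt {w : ℝ × ℝ → ℝ} (hw : ContDiff ℝ 1 w) :
    Continuous fun p : ℝ × ℝ => pt w p.1 p.2 := by
  have h : (fun p : ℝ × ℝ => pt w p.1 p.2) = fun p => fderiv ℝ w p (1, 0) :=
    funext fun p => (hasDerivAt_comp_prodMk_left (hw.differentiable one_ne_zero) p.1 p.2).deriv
  rw [h]
  exact (hw.continuous_fderiv one_ne_zero).clm_apply continuous_const

/-- Energy inequality for a function on `[0, 1]` with dissipative Robin boundary conditions. -/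
theorem integral_mul_deriv_deriv_le_of_robin {ν k l : ℝ} (hl : 0 ≤ l) (hlν : l ≤ ν) (hlk : l ≤ k)
    {f f' f'' : ℝ → ℝ} (hf : ∀ x, HasDerivAt f (f' x) x) (hf' : ∀ x, HasDerivAt f' (f'' x) x)
    (hf'' : Continuous f'') (h0 : ν * f' 0 = k * f 0) (h1 : ν * f' 1 = -k * f 1) :
    ∫ x in (0:ℝ)..1, (2 * f x * (ν * f'' x) + l * f x ^ 2) ≤ 0 := by
  have cf : Continuous f := continuous_iff_continuousAt.2 fun x => (hf x).continuousAt
  have cf' : Continuous f' := continuous_iff_continuousAt.2 fun x => (hf' x).continuousAt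
  let g' : ℝ → ℝ := fun x => 2 * ν * (f' x * f' x + f x * f'' x) +
    l * (2 * f x ^ 2 + (2 * x - 1) * (2 * f x * f' x))
  have cg' : Continuous g' := by fun_prop
  have hg : ∀ x, HasDerivAt
      (fun x => 2 * ν * (f x * f' x) + l * ((2 * x - 1) * f x ^ 2)) (g' x) x := fun x => by
    have h := (((hf x).mul (hf' x)).const_mul (2 * ν)).add
      (((((hasDerivAt_id x).const_mul 2).sub_const 1).mul ((hf x).pow 2)).const_mul l)
    refine h.congr_deriv ?_
    simp [g']
  have hint := intervalIntegral.integral_eq_sub_of_hasDerivAt (a := 0) (b := 1)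
    (fun x _ => hg x) (cg'.intervalIntegrable 0 1)
  have hmono : ∫ x in (0:ℝ)..1, (2 * f x * (ν * f'' x) + l * f x ^ 2) ≤
      ∫ x in (0:ℝ)..1, g' x := by
    refine intervalIntegral.integral_mono_on zero_le_one
      (Continuous.intervalIntegrable (by fun_prop) _ _) (cg'.intervalIntegrable _ _) ?_
    rintro x ⟨hx0, hx1⟩
    have e1 : 0 ≤ (ν - l) * f' x ^ 2 := mul_nonneg (by linarith) (sq_nonneg _)
    have e2 : 0 ≤ l * (f x + (2 * x - 1) * f' x) ^ 2 := mul_nonneg hl (sq_nonneg _)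
    have e3 : 0 ≤ l * (f' x ^ 2 * (1 + 4 * (x * (1 - x)))) :=
      mul_nonneg hl (mul_nonneg (sq_nonneg _) (by nlinarith))
    simp only [g']
    linarith
  have b0 := mul_nonneg (sub_nonneg.2 hlk) (sq_nonneg (f 0))
  have b1 := mul_nonneg (sub_nonneg.2 hlk) (sq_nonneg (f 1))
  have c0 := mul_nonneg (hl.trans hlk) (sq_nonneg (f 0))
  have c1 := mul_nonneg (hl.trans hlk) (sq_nonneg (f 1))
  have e0 : ν * (f 0 * f' 0) = k * f 0 ^ 2 := by linear_combination f 0 * h0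
  have e1 : ν * (f 1 * f' 1) = -k * f 1 ^ 2 := by linear_combination f 1 * h1
  linarith

/-- Grönwall's inequality for a linear differential inequality on `[0, ∞)`. -/
theorem le_mul_exp_of_deriv_add_mul_nonpos {E E' : ℝ → ℝ} {l : ℝ}
    (hE : ∀ t, HasDerivAt E (E' t) t) (hle : ∀ t ≥ 0, E' t + l * E t ≤ 0) {t : ℝ} (ht : 0 ≤ t) :
    E t ≤ E 0 * Real.exp (-l * t) := by
  have hg : ∀ s, HasDerivAt (fun s => E s * Real.exp (l * s))
      ((E' s + l * E s) * Real.exp (l * s)) s := fun s => by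
    refine ((hE s).mul ((hasDerivAt_id s).const_mul l).exp).congr_deriv ?_
    simp only [id, mul_one]
    ring
  have hanti := antitoneOn_of_hasDerivWithinAt_nonpos (convex_Ici (0:ℝ))
    (fun s _ => (hg s).continuousAt.continuousWithinAt) (fun s _ => (hg s).hasDerivWithinAt)
    fun s hs => mul_nonpos_of_nonpos_of_nonneg (hle s (interior_subset hs)) (Real.exp_pos _).le
  have h := hanti Set.self_mem_Ici ht ht
  simp only [mul_zero, Real.exp_zero, mul_one] at h
  rw [neg_mul, Real.exp_neg, ← div_eq_mul_inv]
  exact (le_div_iff₀ (Real.exp_pos _)).2 h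

/-- exponential L²(0,1) decay estimate underlying Theorem 2,
with `λ = min ν k`. -/
theorem stmt_7 (ν k : ℝ) (hν : 0 < ν) (hk : 0 < k) (u : ℝ × ℝ → ℝ)
    (hu : ContDiff ℝ 2 u)
    (hpde : ∀ t ≥ (0:ℝ), ∀ x ∈ Set.Icc (0:ℝ) 1, pt u t x = ν * pxx u t x)
    (hbc0 : ∀ t ≥ (0:ℝ), ν * px u t 0 = k * u (t, 0))
    (hbc1 : ∀ t ≥ (0:ℝ), ν * px u t 1 = -k * u (t, 1)) :
    ∀ t ≥ (0:ℝ),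
      Real.sqrt (∫ x in (0:ℝ)..1, (u (t, x)) ^ 2) ≤
        Real.sqrt (∫ x in (0:ℝ)..1, (u (0, x)) ^ 2) *
          Real.exp (-(min ν k) * t / 2) := by
  have hd : Differentiable ℝ u := hu.differentiable two_ne_zero
  have hu1 : ContDiff ℝ 1 u := hu.of_le one_le_two
  set l := min ν k
  have hl : 0 ≤ l := (lt_min hν hk).le
  have hE : ∀ t, HasDerivAt (fun s => ∫ x in (0:ℝ)..1, u (s, x) ^ 2)
      (∫ x in (0:ℝ)..1, 2 * u (t, x) * pt u t x) t := by
    have hc := hu.continuous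
    have hcpt := continuous_pt hu1
    refine hasDerivAt_intervalIntegral_of_continuous (by fun_prop) (by fun_prop) fun t x => ?_
    refine ((hasDerivAt_comp_prodMk_left hd t x).differentiableAt.hasDerivAt.pow 2).congr_deriv ?_
    simp [pt]
  have hle : ∀ t ≥ 0, (∫ x in (0:ℝ)..1, 2 * u (t, x) * pt u t x) +
      l * ∫ x in (0:ℝ)..1, u (t, x) ^ 2 ≤ 0 := fun t ht => by
    have hf : ContDiff ℝ 2 fun y => u (t, y) := hu.comp (contDiff_const.prodMk contDiff_id)
    have hf' : ContDiff ℝ 1 (px u t) := hf.deriv' (n := 1)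
    have hf'' : Continuous (pxx u t) := hf'.continuous_deriv le_rfl
    have hfc := hf.continuous
    have key := integral_mul_deriv_deriv_le_of_robin hl (min_le_left ν k) (min_le_right ν k)
      (fun x => (hf.differentiable two_ne_zero x).hasDerivAt)
      (fun x => (hf'.differentiable one_ne_zero x).hasDerivAt) hf'' (hbc0 t ht) (hbc1 t ht)
    rw [intervalIntegral.integral_add (Continuous.intervalIntegrable (by
      change Continuous fun x => 2 * u (t, x) * (ν * pxx u t x)
      fun_prop) _ _)
      (Continuous.intervalIntegrable (by fun_prop) _ _),
      intervalIntegral.integral_const_mul] at key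
    refine le_of_eq_of_le (congrArg (· + _) (intervalIntegral.integral_congr fun x hx => ?_)) key
    rw [Set.uIcc_of_le zero_le_one] at hx
    change _ = 2 * u (t, x) * (ν * pxx u t x)
    rw [← hpde t ht x hx]
  intro t ht
  have h := Real.sqrt_le_sqrt (le_mul_exp_of_deriv_add_mul_nonpos hE hle ht)
  rwa [Real.sqrt_mul' _ (Real.exp_pos _).le, ← Real.exp_half] at h
end

section
/- Theorem 1 (exponential tracking for the unstable Burgers equation, nonlinear feedback). Let ν > 0, k > 1/6, and set λ = min(ν, k − 1/6). Let a, u_d : ℝ × ℝ → ℝ be continuous, r : ℝ → ℝ continuously differentiable, and u₀ : ℝ → ℝ continuous on [0,1]. Let û, U : ℝ × ℝ → ℝ be twice continuously differentiable and satisfy, for all t ≥ 0 and x ∈ [0,1]: (i) ∂ₜû = ν·∂ₓₓû − û·∂ₓû with boundary feedback ν·∂ₓû(t,0) = k·(û(t,0) + û(t,0)³), ν·∂ₓû(t,1) = −k·(û(t,1) + û(t,1)³), and initial condition û(0,x) = u₀(x) − r(0); (ii) ∂ₜU = ν·∂ₓₓU − U·∂ₓU + a·(û + U) − (û·∂ₓU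 + U·∂ₓû) + u_d with boundary conditions ν·∂ₓU(t,0) = û(t,0)·U(t,0) + (1/2)·U(t,0)² and ν·∂ₓU(t,1) = û(t,1)·U(t,1) + (1/2)·U(t,1)² + r'(t) − ∫₀¹ [a(t,x)·(û(t,x) + U(t,x)) + u_d(t,x)] dx, and initial condition U(0,x) = r(0). Then the function u = û + U satisfies the controlled Burgers equation ∂ₜu = ν·∂ₓₓu − u·∂ₓu + a·u + u_d with u(0,x) = u₀(x), and the tracking error e(t) = ∫₀¹ u(t,x) dx − r(t) satisfies |e(t)| ≤ (∫₀¹ (u₀(x) − r(0))² dx)^{1/2} · e^{−λt/2} for all t ≥ 0. -/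
theorem hasDerivAt_pt {w : ℝ × ℝ → ℝ} (hw : Differentiable ℝ w) (t x : ℝ) :
    HasDerivAt (fun s => w (s, x)) (pt w t x) t :=
  (by fun_prop : Differentiable ℝ fun s => w (s, x)).differentiableAt.hasDerivAt

theorem hasDerivAt_px {w : ℝ × ℝ → ℝ} (hw : Differentiable ℝ w) (t x : ℝ) :
    HasDerivAt (fun y => w (t, y)) (px w t x) x :=
  (by fun_prop : Differentiable ℝ fun y => w (t, y)).differentiableAt.hasDerivAt

theorem px_eq_fderiv {w : ℝ × ℝ → ℝ} (hw : Differentiable ℝ w) (t x : ℝ) :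
    px w t x = fderiv ℝ w (t, x) (0, 1) :=
  ((hw (t, x)).hasFDerivAt.comp_hasDerivAt x
    ((hasDerivAt_const x t).prodMk (hasDerivAt_id x))).deriv

theorem pt_eq_fderiv {w : ℝ × ℝ → ℝ} (hw : Differentiable ℝ w) (t x : ℝ) :
    pt w t x = fderiv ℝ w (t, x) (1, 0) :=
  ((hw (t, x)).hasFDerivAt.comp_hasDerivAt t
    ((hasDerivAt_id t).prodMk (hasDerivAt_const t x))).deriv

theorem contDiff_px {w : ℝ × ℝ → ℝ} (hw : ContDiff ℝ 2 w) (t : ℝ) :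
    ContDiff ℝ 1 fun x => px w t x := by
  simp only [px_eq_fderiv (hw.differentiable (by norm_num))]
  have h : ContDiff ℝ 1 (fderiv ℝ w) := hw.fderiv_right (by norm_num)
  exact (h.comp (contDiff_const.prodMk contDiff_id)).clm_apply contDiff_const

theorem hasDerivAt_pxx {w : ℝ × ℝ → ℝ} (hw : ContDiff ℝ 2 w) (t x : ℝ) :
    HasDerivAt (fun y => px w t y) (pxx w t x) x :=
  ((contDiff_px hw t).differentiable (by norm_num)).differentiableAt.hasDerivAt

theorem continuous_pxx {w : ℝ × ℝ → ℝ} (hw : ContDiff ℝ 2 w) (t : ℝ) :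
    Continuous fun x => pxx w t x :=
  (contDiff_px hw t).continuous_deriv (by norm_num)

/-- Differentiation under the integral sign for a continuously differentiable integrand. -/
theorem hasDerivAt_integral_pt {w : ℝ × ℝ → ℝ} (hw : ContDiff ℝ 1 w) (t : ℝ) :
    HasDerivAt (fun s => ∫ x in (0:ℝ)..1, w (s, x)) (∫ x in (0:ℝ)..1, pt w t x) t := by
  have hc := hw.continuous
  have hd := continuous_pt hw
  obtain ⟨C, hC⟩ := ((isCompact_Icc (a := t - 1) (b := t + 1)).prod
    (isCompact_Icc (a := (0:ℝ)) (b := 1))).exists_bound_of_continuousOn hd.continuousOn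
  refine (intervalIntegral.hasDerivAt_integral_of_dominated_loc_of_deriv_le
    (F := fun s x => w (s, x)) (F' := fun s x => pt w s x) (bound := fun _ => C)
    (s := Set.Icc (t - 1) (t + 1)) (Icc_mem_nhds (by linarith) (by linarith))
    (.of_forall fun s => (by fun_prop : Continuous fun x => w (s, x)).aestronglyMeasurable)
    ((by fun_prop : Continuous fun x => w (t, x)).intervalIntegrable _ _)
    (hd.comp (by fun_prop : Continuous fun x : ℝ => (t, x))).aestronglyMeasurable
    (.of_forall fun x hx s hs => ?_) intervalIntegrable_const
    (.of_forall fun x _ s _ => hasDerivAt_pt (hw.differentiable (by norm_num)) s x)).2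
  rw [Set.uIoc_of_le zero_le_one] at hx
  exact hC (s, x) ⟨hs, Set.Ioc_subset_Icc_self hx⟩

/-- A Poincaré inequality on the unit interval with boundary terms. -/
theorem integral_sq_le_boundary_add_integral_deriv_sq {f f' : ℝ → ℝ}
    (hf : ∀ x, HasDerivAt f (f' x) x) (hf' : Continuous f') :
    ∫ x in (0:ℝ)..1, f x ^ 2 ≤ f 0 ^ 2 + f 1 ^ 2 + ∫ x in (0:ℝ)..1, f' x ^ 2 := by
  have hc : Continuous f := continuous_iff_continuousAt.2 fun x => (hf x).continuousAt
  have key : ∫ x in (0:ℝ)..1, (f x ^ 2 + (2 * x - 1) * f x * f' x)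
      = (f 1 ^ 2 + f 0 ^ 2) / 2 := by
    rw [intervalIntegral.integral_eq_sub_of_hasDerivAt (f := fun x => (x - 1 / 2) * f x ^ 2)]
    · ring
    · intro x _
      refine (((hasDerivAt_id x).sub_const (1 / 2)).mul ((hf x).pow 2)).congr_deriv ?_
      simp
      ring
    · exact (by fun_prop : Continuous _).intervalIntegrable _ _
  have mono : ∫ x in (0:ℝ)..1, ((f x ^ 2 - f' x ^ 2) / 2)
      ≤ ∫ x in (0:ℝ)..1, (f x ^ 2 + (2 * x - 1) * f x * f' x) := by
    refine intervalIntegral.integral_mono_on zero_le_one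
      ((by fun_prop : Continuous _).intervalIntegrable _ _)
      ((by fun_prop : Continuous _).intervalIntegrable _ _) fun x hx => ?_
    nlinarith [sq_nonneg (f x + (2 * x - 1) * f' x),
      mul_nonneg (mul_nonneg hx.1 (sub_nonneg.2 hx.2)) (sq_nonneg (f' x))]
  rw [key, intervalIntegral.integral_div, intervalIntegral.integral_sub
    ((by fun_prop : Continuous _).intervalIntegrable _ _)
    ((by fun_prop : Continuous _).intervalIntegrable _ _)] at mono
  linarith

theorem abs_integral_le_sqrt_integral_sq {f : ℝ → ℝ} (hf : Continuous f) :
    |∫ x in (0:ℝ)..1, f x| ≤ Real.sqrt (∫ x in (0:ℝ)..1, f x ^ 2) := by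
  refine Real.abs_le_sqrt ?_
  set c := ∫ x in (0:ℝ)..1, f x with hc
  have h : (0:ℝ) ≤ ∫ x in (0:ℝ)..1, (f x - c) ^ 2 :=
    intervalIntegral.integral_nonneg zero_le_one fun x _ => sq_nonneg _
  have e : ∫ x in (0:ℝ)..1, (f x - c) ^ 2 = (∫ x in (0:ℝ)..1, f x ^ 2) - c ^ 2 := by
    have : ∀ x, (f x - c) ^ 2 = f x ^ 2 - 2 * c * f x + c ^ 2 := fun x => by ring
    simp only [this]
    rw [intervalIntegral.integral_add ((by fun_prop : Continuous _).intervalIntegrable _ _)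
      ((by fun_prop : Continuous _).intervalIntegrable _ _),
      intervalIntegral.integral_sub ((by fun_prop : Continuous _).intervalIntegrable _ _)
      ((by fun_prop : Continuous _).intervalIntegrable _ _),
      intervalIntegral.integral_const_mul, intervalIntegral.integral_const, ← hc]
    simp
    ring
  linarith

/-- The energy identity for the viscous Burgers operator. -/
theorem integral_burgers_mul_self {f f' f'' : ℝ → ℝ} (ν : ℝ)
    (hf : ∀ x, HasDerivAt f (f' x) x) (hf' : ∀ x, HasDerivAt f' (f'' x) x)
    (hf'' : Continuous f'') :
    ∫ x in (0:ℝ)..1, 2 * f x * (ν * f'' x - f x * f' x)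
      = 2 * (f 1 * (ν * f' 1) - f 0 * (ν * f' 0)) - 2 / 3 * (f 1 ^ 3 - f 0 ^ 3)
        - 2 * ν * ∫ x in (0:ℝ)..1, f' x ^ 2 := by
  have hc : Continuous f := continuous_iff_continuousAt.2 fun x => (hf x).continuousAt
  have hc' : Continuous f' := continuous_iff_continuousAt.2 fun x => (hf' x).continuousAt
  rw [← intervalIntegral.integral_const_mul, eq_sub_iff_add_eq,
    ← intervalIntegral.integral_add ((by fun_prop : Continuous _).intervalIntegrable _ _)
      ((by fun_prop : Continuous _).intervalIntegrable _ _),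
    intervalIntegral.integral_eq_sub_of_hasDerivAt
      (f := fun x => 2 * (f x * (ν * f' x)) - 2 / 3 * f x ^ 3)]
  · ring
  · intro x _
    refine ((((hf x).mul ((hf' x).const_mul ν)).const_mul 2).sub
      (((hf x).pow 3).const_mul (2 / 3))).congr_deriv ?_
    norm_num
    ring
  · exact (by fun_prop : Continuous _).intervalIntegrable _ _

theorem integral_burgers_mul_self_le {f f' f'' : ℝ → ℝ} {ν k : ℝ} (hν : 0 < ν) (hk : 1 / 6 < k)
    (hf : ∀ x, HasDerivAt f (f' x) x) (hf' : ∀ x, HasDerivAt f' (f'' x) x)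
    (hf'' : Continuous f'') (h0 : ν * f' 0 = k * (f 0 + f 0 ^ 3))
    (h1 : ν * f' 1 = -k * (f 1 + f 1 ^ 3)) :
    ∫ x in (0:ℝ)..1, 2 * f x * (ν * f'' x - f x * f' x)
      ≤ -min ν (k - 1 / 6) * ∫ x in (0:ℝ)..1, f x ^ 2 := by
  have hc' : Continuous f' := continuous_iff_continuousAt.2 fun x => (hf' x).continuousAt
  rw [integral_burgers_mul_self ν hf hf' hf'', h0, h1]
  have hP := integral_sq_le_boundary_add_integral_deriv_sq hf hc'
  have hD : (0:ℝ) ≤ ∫ x in (0:ℝ)..1, f' x ^ 2 :=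
    intervalIntegral.integral_nonneg zero_le_one fun x _ => sq_nonneg _
  set D := ∫ x in (0:ℝ)..1, f' x ^ 2
  set m := min ν (k - 1 / 6) with hm
  have hm0 : 0 < m := lt_min hν (by linarith)
  have hmν : m ≤ ν := min_le_left _ _
  have hmk : m ≤ k - 1 / 6 := min_le_right _ _
  have hb : ∀ y : ℝ, (m + 1 / 3) * y ^ 2 + 1 / 3 * y ^ 4 ≤ 2 * k * (y ^ 2 + y ^ 4) := fun y => by
    have : 0 ≤ y ^ 4 := by positivity
    nlinarith [mul_nonneg (sub_nonneg.2 hmk) (sq_nonneg y), mul_pos hm0 hm0, sq_nonneg y,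
      mul_nonneg (sub_pos.2 hk).le this, mul_nonneg (sub_pos.2 hk).le (sq_nonneg y)]
  have hy0 : f 0 ^ 3 * 2 ≤ f 0 ^ 2 + f 0 ^ 4 := by nlinarith [sq_nonneg (f 0 * (f 0 - 1))]
  have hy1 : -(f 1 ^ 3 * 2) ≤ f 1 ^ 2 + f 1 ^ 4 := by nlinarith [sq_nonneg (f 1 * (f 1 + 1))]
  have hmP := mul_le_mul_of_nonneg_left hP hm0.le
  have hmD : m * D ≤ 2 * ν * D := by nlinarith
  nlinarith [hb (f 0), hb (f 1)]

/-- Gronwall's inequality for exponential decay on the nonnegative half-line. -/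
theorem le_mul_exp_of_deriv_le {E E' : ℝ → ℝ} (c : ℝ) (hE : ∀ t, HasDerivAt E (E' t) t)
    (h : ∀ t ≥ 0, E' t ≤ -c * E t) {t : ℝ} (ht : 0 ≤ t) : E t ≤ E 0 * Real.exp (-c * t) := by
  have hG : ∀ s, HasDerivAt (fun s => E s * Real.exp (c * s))
      (E' s * Real.exp (c * s) + E s * (Real.exp (c * s) * c)) s := fun s =>
    (hE s).mul (by simpa using ((hasDerivAt_id s).const_mul c).exp)
  have hA : AntitoneOn (fun s => E s * Real.exp (c * s)) (Set.Ici 0) := by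
    refine antitoneOn_of_deriv_nonpos (convex_Ici 0)
      (fun s _ => (hG s).continuousAt.continuousWithinAt)
      (fun s _ => (hG s).differentiableAt.differentiableWithinAt) fun s hs => ?_
    rw [interior_Ici] at hs
    rw [(hG s).deriv]
    nlinarith [h s (le_of_lt hs), Real.exp_pos (c * s)]
  have := hA Set.self_mem_Ici ht ht
  simp only [mul_zero, Real.exp_zero, mul_one] at this
  rw [neg_mul, Real.exp_neg, ← div_eq_mul_inv, le_div_iff₀ (Real.exp_pos _)]
  exact this

/-- Theorem 1, exponential tracking for the unstable Burgers
equation with nonlinear boundary feedback and feedforward control. -/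
theorem stmt_13 (ν k : ℝ) (hν : 0 < ν) (hk : 1/6 < k)
    (a ud : ℝ × ℝ → ℝ) (r u₀ : ℝ → ℝ) (uh U : ℝ × ℝ → ℝ)
    (ha : Continuous a) (hud : Continuous ud) (hr : ContDiff ℝ 1 r)
    (hu₀ : ContinuousOn u₀ (Set.Icc (0:ℝ) 1))
    (huh : ContDiff ℝ 2 uh) (hU : ContDiff ℝ 2 U)
    (huh_pde : ∀ t ≥ (0:ℝ), ∀ x ∈ Set.Icc (0:ℝ) 1,
      pt uh t x = ν * pxx uh t x - uh (t, x) * px uh t x)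
    (huh_bc0 : ∀ t ≥ (0:ℝ), ν * px uh t 0 = k * (uh (t, 0) + (uh (t, 0)) ^ 3))
    (huh_bc1 : ∀ t ≥ (0:ℝ), ν * px uh t 1 = -k * (uh (t, 1) + (uh (t, 1)) ^ 3))
    (huh_ic : ∀ x ∈ Set.Icc (0:ℝ) 1, uh (0, x) = u₀ x - r 0)
    (hU_pde : ∀ t ≥ (0:ℝ), ∀ x ∈ Set.Icc (0:ℝ) 1,
      pt U t x = ν * pxx U t x - U (t, x) * px U t x
        + a (t, x) * (uh (t, x) + U (t, x))
        - (uh (t, x) * px U t x + U (t, x) * px uh t x) + ud (t, x))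
    (hU_bc0 : ∀ t ≥ (0:ℝ),
      ν * px U t 0 = uh (t, 0) * U (t, 0) + (1/2) * (U (t, 0)) ^ 2)
    (hU_bc1 : ∀ t ≥ (0:ℝ),
      ν * px U t 1 = uh (t, 1) * U (t, 1) + (1/2) * (U (t, 1)) ^ 2 + deriv r t
        - ∫ x in (0:ℝ)..1,
            (a (t, x) * (uh (t, x) + U (t, x)) + ud (t, x)))
    (hU_ic : ∀ x ∈ Set.Icc (0:ℝ) 1, U (0, x) = r 0) :
    (∀ t ≥ (0:ℝ), ∀ x ∈ Set.Icc (0:ℝ) 1,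
      pt (fun p => uh p + U p) t x
        = ν * pxx (fun p => uh p + U p) t x
          - (uh (t, x) + U (t, x)) * px (fun p => uh p + U p) t x
          + a (t, x) * (uh (t, x) + U (t, x)) + ud (t, x)) ∧
    (∀ x ∈ Set.Icc (0:ℝ) 1, uh (0, x) + U (0, x) = u₀ x) ∧
    (∀ t ≥ (0:ℝ),
      |(∫ x in (0:ℝ)..1, (uh (t, x) + U (t, x))) - r t|
        ≤ Real.sqrt (∫ x in (0:ℝ)..1, (u₀ x - r 0) ^ 2) *
            Real.exp (-(min ν (k - 1/6)) * t / 2)) := by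
  have hdu : Differentiable ℝ uh := huh.differentiable (by norm_num)
  have hdU : Differentiable ℝ U := hU.differentiable (by norm_num)
  have hcu := huh.continuous
  have hcU := hU.continuous
  have hpx : ∀ t x, px (fun p => uh p + U p) t x = px uh t x + px U t x := fun t x =>
    ((hasDerivAt_px hdu t x).add (hasDerivAt_px hdU t x)).deriv
  have hpxx : ∀ t x, pxx (fun p => uh p + U p) t x = pxx uh t x + pxx U t x := fun t x => by
    simp only [pxx, hpx]
    exact ((hasDerivAt_pxx huh t x).add (hasDerivAt_pxx hU t x)).deriv
  have hpt : ∀ t x, pt (fun p => uh p + U p) t x = pt uh t x + pt U t x := fun t x =>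
    ((hasDerivAt_pt hdu t x).add (hasDerivAt_pt hdU t x)).deriv
  refine ⟨fun t ht x hx => ?_, fun x hx => ?_, fun t ht => ?_⟩
  · rw [hpt, hpx, hpxx, huh_pde t ht x hx, hU_pde t ht x hx]
    ring
  · rw [huh_ic x hx, hU_ic x hx]
    ring
  have hmass : ∀ s ≥ 0, ∫ x in (0:ℝ)..1, pt U s x = deriv r s := fun s hs => by
    have hcux : Continuous fun x => px uh s x := (contDiff_px huh s).continuous
    have hcUx : Continuous fun x => px U s x := (contDiff_px hU s).continuous
    have hcUxx := continuous_pxx hU s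
    have hflux : ∫ x in (0:ℝ)..1, (ν * pxx U s x - U (s, x) * px U s x
        - (uh (s, x) * px U s x + U (s, x) * px uh s x))
        = deriv r s - ∫ x in (0:ℝ)..1, (a (s, x) * (uh (s, x) + U (s, x)) + ud (s, x)) := by
      rw [intervalIntegral.integral_eq_sub_of_hasDerivAt
        (f := fun x => ν * px U s x - 1 / 2 * U (s, x) ^ 2 - uh (s, x) * U (s, x))]
      · linarith [hU_bc0 s hs, hU_bc1 s hs]
      · intro x _
        refine ((((hasDerivAt_pxx hU s x).const_mul ν).sub
          (((hasDerivAt_px hdU s x).pow 2).const_mul (1 / 2))).sub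
          ((hasDerivAt_px hdu s x).mul (hasDerivAt_px hdU s x))).congr_deriv ?_
        simp
        ring
      · exact (by fun_prop : Continuous _).intervalIntegrable _ _
    rw [eq_sub_iff_add_eq, ← intervalIntegral.integral_add
      ((by fun_prop : Continuous _).intervalIntegrable _ _)
      ((by fun_prop : Continuous _).intervalIntegrable _ _)] at hflux
    rw [← hflux]
    refine intervalIntegral.integral_congr fun x hx => ?_
    rw [Set.uIcc_of_le zero_le_one] at hx
    simp only [hU_pde s hs x hx]
    ring
  have hUr : ∫ x in (0:ℝ)..1, U (t, x) = r t := by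
    have hd : ∀ s, HasDerivAt (fun s => (∫ x in (0:ℝ)..1, U (s, x)) - r s)
        ((∫ x in (0:ℝ)..1, pt U s x) - deriv r s) s := fun s =>
      (hasDerivAt_integral_pt (hU.of_le (by norm_num)) s).sub
        (hr.differentiable (by norm_num)).differentiableAt.hasDerivAt
    have hconst := constant_of_has_deriv_right_zero (a := 0) (b := t)
      (fun s _ => (hd s).continuousAt.continuousWithinAt)
      (fun s hs => by simpa [hmass s hs.1] using (hd s).hasDerivWithinAt) t ⟨ht, le_rfl⟩
    have h0 : ∫ x in (0:ℝ)..1, U (0, x) = r 0 := by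
      rw [intervalIntegral.integral_congr (g := fun _ => r 0) fun x hx => hU_ic x
        (by rwa [Set.uIcc_of_le zero_le_one] at hx)]
      simp
    simp only [h0, sub_self] at hconst
    linarith
  have hptsq : ∀ s x, pt (fun p => uh p ^ 2) s x = 2 * uh (s, x) * pt uh s x := fun s x => by
    refine ((hasDerivAt_pt hdu s x).pow 2).deriv.trans ?_
    simp
  have henergy : ∫ x in (0:ℝ)..1, uh (t, x) ^ 2
      ≤ (∫ x in (0:ℝ)..1, uh (0, x) ^ 2) * Real.exp (-min ν (k - 1 / 6) * t) := by
    refine le_mul_exp_of_deriv_le (E := fun s => ∫ x in (0:ℝ)..1, uh (s, x) ^ 2) _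
      (fun s => hasDerivAt_integral_pt (w := fun p => uh p ^ 2)
        ((huh.of_le (by norm_num)).pow 2) s) (fun s hs => ?_) ht
    refine le_of_eq_of_le (intervalIntegral.integral_congr fun x hx => ?_)
      (integral_burgers_mul_self_le hν hk (hasDerivAt_px hdu s) (hasDerivAt_pxx huh s)
        (continuous_pxx huh s) (huh_bc0 s hs) (huh_bc1 s hs))
    rw [Set.uIcc_of_le zero_le_one] at hx
    simp only [hptsq, huh_pde s hs x hx]
  have hinit : ∫ x in (0:ℝ)..1, uh (0, x) ^ 2 = ∫ x in (0:ℝ)..1, (u₀ x - r 0) ^ 2 :=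
    intervalIntegral.integral_congr fun x hx => by
      rw [Set.uIcc_of_le zero_le_one] at hx
      simp only [huh_ic x hx]
  rw [intervalIntegral.integral_add ((by fun_prop : Continuous _).intervalIntegrable _ _)
    ((by fun_prop : Continuous _).intervalIntegrable _ _), hUr, add_sub_cancel_right, ← hinit,
    Real.exp_half, ← Real.sqrt_mul (intervalIntegral.integral_nonneg zero_le_one
      fun x _ => sq_nonneg _)]
  exact (abs_integral_le_sqrt_integral_sq (by fun_prop)).trans (Real.sqrt_le_sqrt henergy)
end
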